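/- Let ρ_M : S² → ℝ be a continuous strictly positive function on the unit sphere of ℝ³ satisfying ρ_M(u) = ρ_M(−u) for all u and invariant under every rotation of ℝ³ about the x₃-axis (so ρ_M(cos θ cos φ, cos θ sin φ, sin θ) depends only on θ). Fix R > 0 and for 0 < c < 1 and 0 ≤ d < 1 let K(c,d) = {λ·u : u ∈ S², 0 ≤ λ ≤ R·ρ_M(u)·(1 + d·ρ_c(u))} ⊂ ℝ³, where ρ_c(u) denotes ρ_c(θ, φ) in the spherical coordinates u = (cos θ cos φ, cos θ sin φ, sin θ). Then there exist constants 0 < c₁ < c₂ < 1 and 0 < d₀ < 1 and a function F : (0, d₀) → [c₁, c₂] such that for every d ∈ (0, d₀) the centroid of K(F(d), d) is the origin, i.e. ∫_{K(F(d),d)} x dλ₃(x) = 0 ∈ ℝ³. (This is Lemma 4.11, the centering lemma for the mono-monostatic construction in a rotationally symmetric normed 3-space whose unit ball has radial function ρ_M.) -/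

import Mathlib

open Real MeasureTheory

/-- The function `F_c` of the Várkonyi–Domokos construction. -/
noncomputable def Fc (c x : ℝ) : ℝ :=
  (c * x^2 + (1 - c) * (1 - x)^2 * (c * x / (c + x))) / (c * x + (1 - c) * (1 - x)^2)

noncomputable def fc (c θ : ℝ) : ℝ := π * Fc c (θ / π + 1/2) - π / 2

noncomputable def gc (c θ : ℝ) : ℝ := - fc c (-θ)

noncomputable def ac (c θ φ : ℝ) : ℝ :=
  cos φ ^ 2 * cos (fc c θ) ^ 2 /
    (cos φ ^ 2 * cos (fc c θ) ^ 2 + sin φ ^ 2 * cos (gc c θ) ^ 2)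

open Classical in
/-- The function `ρ_c(θ, φ)`, with values `±1` at the poles `θ = ±π/2`. -/
noncomputable def rhoc (c θ φ : ℝ) : ℝ :=
  if θ = π/2 then 1
  else if θ = -(π/2) then -1
  else ac c θ φ * sin (fc c θ) + (1 - ac c θ φ) * sin (gc c θ)

/-- The point of `S²` with spherical coordinates `(θ, φ)`. -/
noncomputable def sph (θ φ : ℝ) : EuclideanSpace ℝ (Fin 3) :=
  (EuclideanSpace.equiv (Fin 3) ℝ).symm ![cos θ * cos φ, cos θ * sin φ, sin θ]

/-- The star-shaped body with radial function `R·ρ_M·(1 + d·ρ_c)`. -/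
noncomputable def KbodyM (ρM : EuclideanSpace ℝ (Fin 3) → ℝ) (R c d : ℝ) :
    Set (EuclideanSpace ℝ (Fin 3)) :=
  {x | ∃ θ ∈ Set.Icc (-(π/2)) (π/2), ∃ φ ∈ Set.Ico 0 (2*π), ∃ l : ℝ,
    0 ≤ l ∧ l ≤ R * ρM (sph θ φ) * (1 + d * rhoc c θ φ) ∧ x = l • sph θ φ}


/-- The quotient `F_c(x) / c`, which extends continuously to `c = 0`. -/
noncomputable def slopeFc (c x : ℝ) : ℝ :=
  (x^2 + (1 - c) * (1 - x)^2 * (x / (c + x))) / (c * x + (1 - c) * (1 - x)^2)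

/-- The quotient `cos f_c(θ) / c` at `θ = π (x - 1/2)`, extended continuously to `c = 0`. -/
noncomputable def slopeCos (c x : ℝ) : ℝ := slopeFc c x * sinc (π * (c * slopeFc c x))

theorem Fc_eq_mul_slopeFc (c x : ℝ) : Fc c x = c * slopeFc c x := by
  unfold Fc slopeFc
  ring

theorem slopeFc_denom_pos {c x : ℝ} (hc : c ∈ Set.Icc (0 : ℝ) 1) (hx : x ∈ Set.Ioo (0 : ℝ) 1) :
    0 < c * x + (1 - c) * (1 - x)^2 := by
  obtain ⟨h0, h1⟩ := hc
  obtain ⟨hx0, hx1⟩ := hx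
  have hsq : 0 < (1 - x)^2 := pow_pos (by linarith) 2
  rcases h0.eq_or_lt with rfl | h0
  · simpa using hsq
  · have := mul_pos h0 hx0
    have := mul_nonneg (sub_nonneg.2 h1) hsq.le
    linarith

theorem slopeFc_pos {c x : ℝ} (hc : c ∈ Set.Icc (0 : ℝ) 1) (hx : x ∈ Set.Ioo (0 : ℝ) 1) :
    0 < slopeFc c x := by
  have hd := slopeFc_denom_pos hc hx
  obtain ⟨h0, h1⟩ := hc
  obtain ⟨hx0, hx1⟩ := hx
  have h1' := sub_nonneg.2 h1
  unfold slopeFc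
  positivity

theorem mul_slopeFc_lt_one {c x : ℝ} (hc : c ∈ Set.Icc (0 : ℝ) 1) (hx : x ∈ Set.Ioo (0 : ℝ) 1) :
    c * slopeFc c x < 1 := by
  have hd := slopeFc_denom_pos hc hx
  obtain ⟨h0, h1⟩ := hc
  obtain ⟨hx0, hx1⟩ := hx
  have hcx : 0 < c + x := by linarith
  have hfrac : c * (x / (c + x)) < 1 := by
    rw [← mul_div_assoc, div_lt_one hcx]
    nlinarith
  unfold slopeFc
  rw [← mul_div_assoc, div_lt_one hd]
  have hsq : 0 < (1 - x)^2 := pow_pos (by linarith) 2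
  rcases h0.eq_or_lt with rfl | h0
  · simpa using hsq
  · have h2 : 0 < c * (x - x^2) := mul_pos h0 (by nlinarith)
    have h3 := mul_nonneg (mul_nonneg (sub_nonneg.2 h1) hsq.le) (sub_nonneg.2 hfrac.le)
    nlinarith

theorem continuousOn_slopeFc {x : ℝ} (hx : x ∈ Set.Ioo (0 : ℝ) 1) :
    ContinuousOn (fun c => slopeFc c x) (Set.Icc 0 1) := by
  unfold slopeFc
  refine ContinuousOn.div ?_ (by fun_prop) fun c hc => (slopeFc_denom_pos hc hx).ne'
  refine ContinuousOn.add (by fun_prop) (ContinuousOn.mul (by fun_prop) ?_)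
  exact continuousOn_const.div (by fun_prop) fun c hc => by linarith [hc.1, hx.1]

theorem slopeCos_pos {c x : ℝ} (hc : c ∈ Set.Icc (0 : ℝ) 1) (hx : x ∈ Set.Ioo (0 : ℝ) 1) :
    0 < slopeCos c x := by
  have h1 := slopeFc_pos hc hx
  have h2 := mul_slopeFc_lt_one hc hx
  refine mul_pos h1 ?_
  rcases (mul_nonneg hc.1 h1.le).eq_or_lt with h | h
  · simp [← h]
  · rw [sinc_of_ne_zero (by positivity)]
    exact div_pos (sin_pos_of_pos_of_lt_pi (by positivity) (by nlinarith [pi_pos])) (by positivity)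

theorem continuousOn_slopeCos {x : ℝ} (hx : x ∈ Set.Ioo (0 : ℝ) 1) :
    ContinuousOn (fun c => slopeCos c x) (Set.Icc 0 1) := by
  have h := continuousOn_slopeFc hx
  exact h.mul (continuous_sinc.comp_continuousOn (continuousOn_const.mul (continuousOn_id.mul h)))

theorem measurable_slopeFc (c : ℝ) : Measurable (slopeFc c) := by
  unfold slopeFc
  fun_prop

theorem measurable_slopeCos (c : ℝ) : Measurable (slopeCos c) := by
  have h := measurable_slopeFc c
  exact h.mul (continuous_sinc.measurable.comp ((h.const_mul c).const_mul π))

theorem sin_fc (c θ : ℝ) : sin (fc c θ) = -cos (π * (c * slopeFc c (θ / π + 1/2))) := by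
  rw [fc, Fc_eq_mul_slopeFc, sin_sub_pi_div_two]

theorem cos_fc {c : ℝ} (hc : 0 < c) {θ : ℝ} (hx : θ / π + 1/2 ∈ Set.Ioo (0 : ℝ) 1)
    (hc1 : c ≤ 1) :
    cos (fc c θ) = π * c * slopeCos c (θ / π + 1/2) := by
  have h := slopeFc_pos ⟨hc.le, hc1⟩ hx
  rw [fc, Fc_eq_mul_slopeFc, cos_sub_pi_div_two, slopeCos, sinc_of_ne_zero (by positivity)]
  generalize slopeFc c (θ / π + 1/2) = q at h ⊢
  field_simp

theorem slopeFc_one {x : ℝ} (hx : x ∈ Set.Ioo (0 : ℝ) 1) : slopeFc 1 x = x := by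
  have := hx.1.ne'
  simp [slopeFc]
  field_simp

theorem slopeCos_zero_lt {x : ℝ} (hx : x ∈ Set.Ioo (0 : ℝ) 1) (h : x < 1 - x) :
    slopeCos 0 x < slopeCos 0 (1 - x) := by
  obtain ⟨hx0, hx1⟩ := hx
  have h1 : x ≠ 0 := hx0.ne'
  have h2 : (1 - x) ≠ 0 := (sub_pos.2 hx1).ne'
  have hsq : x^2 < (1 - x)^2 := by nlinarith
  simp only [slopeCos, slopeFc, zero_mul, mul_zero, sinc_zero, mul_one, zero_add, sub_zero,
    one_mul, sub_sub_cancel, div_self h1, div_self h2]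
  rw [add_comm]
  have : 0 < (1 - x)^2 := by positivity
  have : 0 < x^2 := by positivity
  gcongr

/-- Euclidean three-space. -/
abbrev Euclid3 := EuclideanSpace ℝ (Fin 3)

/-- The latitude of `x`, rescaled to `[0, 1]`. -/
noncomputable def latitude (x : Euclid3) : ℝ := arcsin (x 2 / ‖x‖) / π + 1/2

/-- The weight `a_c`, as a function of a point of space. -/
noncomputable def weightExt (c : ℝ) (x : Euclid3) : ℝ :=
  x 0 ^ 2 * slopeCos c (latitude x) ^ 2 /
    (x 0 ^ 2 * slopeCos c (latitude x) ^ 2 + x 1 ^ 2 * slopeCos c (1 - latitude x) ^ 2)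

/-- The function `ρ_c` as a function homogeneous of degree `0`, extended to `c = 0`. -/
noncomputable def rhoExt (c : ℝ) (x : Euclid3) : ℝ :=
  weightExt c x * -cos (π * (c * slopeFc c (latitude x))) +
    (1 - weightExt c x) * cos (π * (c * slopeFc c (1 - latitude x)))

theorem norm_sq_eq (x : Euclid3) : ‖x‖ ^ 2 = x 0 ^ 2 + x 1 ^ 2 + x 2 ^ 2 := by
  simp [EuclideanSpace.norm_sq_eq, Fin.sum_univ_three]

theorem measurable_coord (i : Fin 3) : Measurable fun x : Euclid3 => x i := by fun_prop

theorem measurable_latitude : Measurable latitude := by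
  unfold latitude
  exact ((continuous_arcsin.measurable.comp
    ((measurable_coord 2).div measurable_norm)).div_const _).add_const _

theorem measurable_rhoExt (c : ℝ) : Measurable (rhoExt c) := by
  have hl := measurable_latitude
  have hl' : Measurable fun x => 1 - latitude x := hl.const_sub 1
  have h1 := (measurable_slopeCos c).comp hl
  have h2 := (measurable_slopeCos c).comp hl'
  have h3 := (measurable_slopeFc c).comp hl
  have h4 := (measurable_slopeFc c).comp hl'
  simp only [Function.comp_def] at h1 h2 h3 h4
  have h5 : Measurable (weightExt c) := by
    unfold weightExt
    fun_prop
  unfold rhoExt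
  fun_prop

theorem weightExt_mem (c : ℝ) (x : Euclid3) : weightExt c x ∈ Set.Icc (0 : ℝ) 1 := by
  refine ⟨by unfold weightExt; positivity, div_le_one_of_le₀ ?_ (by positivity)⟩
  exact le_add_of_nonneg_right (by positivity)

theorem abs_rhoExt_le (c : ℝ) (x : Euclid3) : |rhoExt c x| ≤ 1 := by
  obtain ⟨h0, h1⟩ := weightExt_mem c x
  have hp := neg_one_le_cos (π * (c * slopeFc c (latitude x)))
  have hp' := cos_le_one (π * (c * slopeFc c (latitude x)))
  have hq := neg_one_le_cos (π * (c * slopeFc c (1 - latitude x)))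
  have hq' := cos_le_one (π * (c * slopeFc c (1 - latitude x)))
  rw [rhoExt, abs_le]
  constructor <;> nlinarith

theorem latitude_smul {r : ℝ} (hr : 0 < r) (x : Euclid3) : latitude (r • x) = latitude x := by
  simp only [latitude, norm_smul, PiLp.smul_apply, smul_eq_mul, norm_of_nonneg hr.le]
  rw [mul_div_mul_left _ _ hr.ne']

theorem rhoExt_smul (c : ℝ) {r : ℝ} (hr : 0 < r) (x : Euclid3) :
    rhoExt c (r • x) = rhoExt c x := by
  have h : weightExt c (r • x) = weightExt c x := by
    simp only [weightExt, latitude_smul hr, PiLp.smul_apply, smul_eq_mul, mul_pow, mul_assoc,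
      ← mul_add]
    rw [mul_div_mul_left _ _ (by positivity)]
  rw [rhoExt, rhoExt, h, latitude_smul hr]

theorem rhoExt_congr (c : ℝ) {x y : Euclid3} (h0 : x 0 ^ 2 = y 0 ^ 2) (h1 : x 1 ^ 2 = y 1 ^ 2)
    (h2 : x 2 = y 2) : rhoExt c x = rhoExt c y := by
  have hn : ‖x‖ = ‖y‖ := by
    rw [← sq_eq_sq₀ (norm_nonneg _) (norm_nonneg _), norm_sq_eq, norm_sq_eq, h0, h1, h2]
  have hl : latitude x = latitude y := by rw [latitude, latitude, hn, h2]
  rw [rhoExt, rhoExt, weightExt, weightExt, hl, h0, h1]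

theorem abs_coord_le_norm (x : Euclid3) (i : Fin 3) : |x i| ≤ ‖x‖ := by
  simpa using PiLp.norm_apply_le x i

theorem coord_div_norm_mem {x : Euclid3} (hx : x 0 ≠ 0 ∨ x 1 ≠ 0) :
    x 2 / ‖x‖ ∈ Set.Ioo (-1 : ℝ) 1 := by
  have hpos : 0 < x 0 ^ 2 + x 1 ^ 2 := by
    rcases hx with h | h <;> positivity
  have hlt : x 2 ^ 2 < ‖x‖ ^ 2 := by rw [norm_sq_eq]; linarith
  have h := abs_lt_of_sq_lt_sq' hlt (norm_nonneg x)
  have hn : 0 < ‖x‖ := by linarith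
  constructor
  · rw [lt_div_iff₀ hn]; linarith
  · rw [div_lt_one hn]; linarith

theorem latitude_mem {x : Euclid3} (hx : x 0 ≠ 0 ∨ x 1 ≠ 0) :
    latitude x ∈ Set.Ioo (0 : ℝ) 1 := by
  obtain ⟨h1, h2⟩ := coord_div_norm_mem hx
  have h3 := neg_pi_div_two_lt_arcsin.2 h1
  have h4 := arcsin_lt_pi_div_two.2 h2
  unfold latitude
  constructor
  · rw [← sub_lt_iff_lt_add, lt_div_iff₀ pi_pos]; linarith
  · rw [← lt_sub_iff_add_lt, div_lt_iff₀ pi_pos]; linarith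

theorem one_sub_mem {t : ℝ} (ht : t ∈ Set.Ioo (0 : ℝ) 1) : 1 - t ∈ Set.Ioo (0 : ℝ) 1 :=
  ⟨by linarith [ht.2], by linarith [ht.1]⟩

theorem weightExt_denom_pos {c : ℝ} (hc : c ∈ Set.Icc (0 : ℝ) 1) {x : Euclid3}
    (hx : x 0 ≠ 0 ∨ x 1 ≠ 0) :
    0 < x 0 ^ 2 * slopeCos c (latitude x) ^ 2 + x 1 ^ 2 * slopeCos c (1 - latitude x) ^ 2 := by
  have h1 := slopeCos_pos hc (latitude_mem hx)
  have h2 := slopeCos_pos hc (one_sub_mem (latitude_mem hx))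
  rcases hx with h | h <;> positivity

theorem continuousOn_rhoExt {x : Euclid3} (hx : x 0 ≠ 0 ∨ x 1 ≠ 0) :
    ContinuousOn (fun c => rhoExt c x) (Set.Icc 0 1) := by
  have ht := latitude_mem hx
  have h1 := continuousOn_slopeCos ht
  have h2 := continuousOn_slopeCos (one_sub_mem ht)
  have h3 := continuousOn_slopeFc ht
  have h4 := continuousOn_slopeFc (one_sub_mem ht)
  have h5 : ContinuousOn (fun c => weightExt c x) (Set.Icc 0 1) := by
    unfold weightExt
    exact ContinuousOn.div (by fun_prop) (by fun_prop) fun c hc => (weightExt_denom_pos hc hx).ne'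
  unfold rhoExt
  fun_prop

theorem rhoExt_one {x : Euclid3} (hx : x 0 ≠ 0 ∨ x 1 ≠ 0) : rhoExt 1 x = x 2 / ‖x‖ := by
  have ht := latitude_mem hx
  obtain ⟨h1, h2⟩ := coord_div_norm_mem hx
  have hcos : cos (π * latitude x) = -(x 2 / ‖x‖) := by
    have : π * latitude x = arcsin (x 2 / ‖x‖) + π / 2 := by
      unfold latitude; field_simp
    rw [this, cos_add_pi_div_two, sin_arcsin h1.le h2.le]
  rw [rhoExt, slopeFc_one ht, slopeFc_one (one_sub_mem ht), one_mul, one_mul, mul_sub, mul_one,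
    cos_pi_sub, hcos]
  ring

theorem coord_mul_rhoExt_zero_lt {x : Euclid3} (h0 : x 0 ≠ 0) (h1 : x 1 ≠ 0) (h2 : x 2 ≠ 0) :
    x 2 * rhoExt 0 x < x 2 * ((x 1 ^ 2 - x 0 ^ 2) / (x 0 ^ 2 + x 1 ^ 2)) := by
  have hx : x 0 ≠ 0 ∨ x 1 ≠ 0 := .inl h0
  have ht := latitude_mem hx
  have hs := slopeCos_pos (Set.left_mem_Icc.2 zero_le_one) ht
  have hs' := slopeCos_pos (Set.left_mem_Icc.2 zero_le_one) (one_sub_mem ht)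
  have hd := weightExt_denom_pos (Set.left_mem_Icc.2 zero_le_one) hx
  have hr : rhoExt 0 x = 1 - 2 * weightExt 0 x := by
    simp [rhoExt]; ring
  have hn : 0 < ‖x‖ := norm_pos_iff.2 fun h => h0 (by simp [h])
  have hp0 : 0 < x 0 ^ 2 := by positivity
  have hp1 : 0 < x 1 ^ 2 := by positivity
  have key : (x 1 ^ 2 - x 0 ^ 2) / (x 0 ^ 2 + x 1 ^ 2) = 1 - 2 * (x 0 ^ 2 / (x 0 ^ 2 + x 1 ^ 2)) := by
    field_simp
    ring
  rw [hr, key]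
  rcases h2.lt_or_gt with h2 | h2
  · have hlt : latitude x < 1 - latitude x := by
      have := div_neg_of_neg_of_pos (arcsin_lt_zero.2 (div_neg_of_neg_of_pos h2 hn)) pi_pos
      unfold latitude; linarith
    have hS := pow_lt_pow_left₀ (slopeCos_zero_lt ht hlt) hs.le two_ne_zero
    have : weightExt 0 x < x 0 ^ 2 / (x 0 ^ 2 + x 1 ^ 2) := by
      rw [weightExt, div_lt_div_iff₀ hd (by positivity)]
      nlinarith [mul_pos (mul_pos hp0 hp1) (sub_pos.2 hS)]
    exact mul_lt_mul_of_neg_left (by linarith) h2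
  · have hlt : 1 - latitude x < 1 - (1 - latitude x) := by
      have := div_pos (arcsin_pos.2 (div_pos h2 hn)) pi_pos
      unfold latitude; linarith
    have hS := pow_lt_pow_left₀ (slopeCos_zero_lt (one_sub_mem ht) hlt) hs'.le two_ne_zero
    rw [sub_sub_cancel] at hS
    have : x 0 ^ 2 / (x 0 ^ 2 + x 1 ^ 2) < weightExt 0 x := by
      rw [weightExt, div_lt_div_iff₀ (by positivity) hd]
      nlinarith [mul_pos (mul_pos hp0 hp1) (sub_pos.2 hS)]
    exact mul_lt_mul_of_pos_left (by linarith) h2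

@[simp] theorem sph_zero (θ φ : ℝ) : sph θ φ 0 = cos θ * cos φ := rfl

@[simp] theorem sph_one (θ φ : ℝ) : sph θ φ 1 = cos θ * sin φ := rfl

@[simp] theorem sph_two (θ φ : ℝ) : sph θ φ 2 = sin θ := rfl

@[simp] theorem norm_sph (θ φ : ℝ) : ‖sph θ φ‖ = 1 := by
  rw [← sq_eq_sq₀ (norm_nonneg _) zero_le_one, norm_sq_eq]
  simp only [sph_zero, sph_one, sph_two]
  linear_combination cos θ ^ 2 * sin_sq_add_cos_sq φ + sin_sq_add_cos_sq θ

theorem rhoc_eq_rhoExt {c θ : ℝ} (hc : c ∈ Set.Ioo (0 : ℝ) 1)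
    (hθ : θ ∈ Set.Ioo (-(π/2)) (π/2)) (φ : ℝ) : rhoc c θ φ = rhoExt c (sph θ φ) := by
  have hl : latitude (sph θ φ) = θ / π + 1/2 := by
    simp [latitude, arcsin_sin hθ.1.le hθ.2.le]
  have ht : θ / π + 1/2 ∈ Set.Ioo (0 : ℝ) 1 := by
    constructor
    · rw [← sub_lt_iff_lt_add, lt_div_iff₀ pi_pos]; linarith [hθ.1]
    · rw [← lt_sub_iff_add_lt, div_lt_iff₀ pi_pos]; linarith [hθ.2]
  have hneg : -θ / π + 1/2 = 1 - (θ / π + 1/2) := by ring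
  have ht' := one_sub_mem ht
  have hw : ac c θ φ = weightExt c (sph θ φ) := by
    have hcos : 0 < cos θ := cos_pos_of_mem_Ioo hθ
    have hc0 := hc.1
    rw [ac, weightExt, gc, cos_neg, cos_fc hc.1 ht hc.2.le,
      cos_fc hc.1 (hneg ▸ ht') hc.2.le, hneg, hl, sph_zero, sph_one]
    rw [← mul_div_mul_left _ (_ + _ : ℝ) (show cos θ ^ 2 / (π * c) ^ 2 ≠ 0 by positivity)]
    congr 1 <;> field_simp
  rw [rhoc, if_neg hθ.2.ne, if_neg hθ.1.ne', hw, rhoExt, gc, sin_neg, sin_fc, sin_fc, neg_neg,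
    hneg, hl]

theorem integral_polar {f : Euclid3 → ℝ} (hf : Integrable f) :
    ∫ x, f x = ∫ u : Metric.sphere (0 : Euclid3) 1,
      (∫ r in Set.Ioi (0 : ℝ), r ^ 2 * f (r • (u : Euclid3))) ∂(volume : Measure Euclid3).toSphere := by
  have hmp := (volume : Measure Euclid3).measurePreserving_homeomorphUnitSphereProd
  have hemb := (homeomorphUnitSphereProd Euclid3).measurableEmbedding
  rw [finrank_euclideanSpace_fin] at hmp
  let g : Metric.sphere (0 : Euclid3) 1 × Set.Ioi (0 : ℝ) → ℝ := fun p => f (p.2.1 • p.1.1)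
  have hg : ∀ x : ({0}ᶜ : Set Euclid3), g (homeomorphUnitSphereProd Euclid3 x) = f x := by
    intro x
    have hx : ‖(x : Euclid3)‖ ≠ 0 := norm_ne_zero_iff.2 x.2
    simp [g, smul_smul, hx]
  have hgi : Integrable g
      ((volume : Measure Euclid3).toSphere.prod (Measure.volumeIoiPow (3 - 1))) := by
    rw [← hmp.integrable_comp_emb hemb]
    have : g ∘ homeomorphUnitSphereProd Euclid3 = f ∘ Subtype.val := funext hg
    rw [this, ← integrableOn_iff_comap_subtypeVal (measurableSet_singleton _).compl]
    exact hf.integrableOn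
  calc ∫ x, f x = ∫ x : ({0}ᶜ : Set Euclid3), f x ∂(volume.comap Subtype.val) := by
        rw [integral_subtype_comap (measurableSet_singleton _).compl f,
          restrict_compl_singleton]
    _ = ∫ p, g p ∂((volume : Measure Euclid3).toSphere.prod (Measure.volumeIoiPow (3 - 1))) := by
        rw [← hmp.integral_comp hemb]
        simp_rw [hg]
    _ = _ := by
        rw [integral_prod _ hgi]
        refine integral_congr_ae (.of_forall fun u => ?_)
        simp only [Measure.volumeIoiPow, ENNReal.ofReal, g]
        rw [integral_withDensity_eq_integral_smul,
          integral_subtype_comap measurableSet_Ioi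
            fun r ↦ Real.toNNReal (r ^ (3 - 1)) • f (r • (u : Euclid3))]
        · refine setIntegral_congr_fun measurableSet_Ioi fun r hr => ?_
          simp [NNReal.smul_def, Real.coe_toNNReal _ (sq_nonneg r)]
        · exact (measurable_subtype_coe.pow_const _).real_toNNReal

section StarBody

variable {h k : Euclid3 → ℝ} {H B : ℝ}

theorem integrableOn_star (hm : Measurable h) (km : Measurable k)
    (hH : ∀ x, h x ≤ H) (kB : ∀ x, |k x| ≤ B) (i : Fin 3) :
    IntegrableOn (fun x => x i * k x) {x | ‖x‖ ≤ h x} := by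
  have hsub : {x | ‖x‖ ≤ h x} ⊆ Metric.closedBall (0 : Euclid3) H := fun x hx =>
    mem_closedBall_zero_iff.2 (le_trans hx (hH x))
  refine IntegrableOn.of_bound ((measure_mono hsub).trans_lt measure_closedBall_lt_top)
    ((measurable_coord i).mul km).aestronglyMeasurable (H * B) ?_
  refine (ae_restrict_iff' (measurableSet_le measurable_norm hm)).2 (.of_forall fun x hx => ?_)
  have hx' : ‖x‖ ≤ H := le_trans hx (hH x)
  rw [norm_mul, norm_eq_abs, norm_eq_abs]
  exact mul_le_mul ((abs_coord_le_norm x i).trans hx') (kB x) (abs_nonneg _)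
    ((norm_nonneg x).trans hx')

theorem setIntegral_star (hm : Measurable h) (km : Measurable k)
    (hh : ∀ r : ℝ, 0 < r → ∀ x, h (r • x) = h x) (kh : ∀ r : ℝ, 0 < r → ∀ x, k (r • x) = k x)
    (h0 : ∀ x, 0 ≤ h x) (hH : ∀ x, h x ≤ H) (kB : ∀ x, |k x| ≤ B) (i : Fin 3) :
    ∫ x in {x | ‖x‖ ≤ h x}, x i * k x = ∫ u : Metric.sphere (0 : Euclid3) 1,
      (u : Euclid3) i * (k u * h u ^ 4) / 4 ∂(volume : Measure Euclid3).toSphere := by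
  have hA : MeasurableSet {x | ‖x‖ ≤ h x} := measurableSet_le measurable_norm hm
  have hint := (integrable_indicator_iff hA).2 (integrableOn_star hm km hH kB i)
  rw [← integral_indicator hA, integral_polar hint]
  refine integral_congr_ae (.of_forall fun u => ?_)
  have hu : ‖(u : Euclid3)‖ = 1 := by simp
  have hfun : Set.EqOn (fun r : ℝ => r ^ 2 * Set.indicator {x | ‖x‖ ≤ h x} (fun x => x i * k x)
      (r • (u : Euclid3)))
      ((Set.Iic (h u)).indicator fun r => (u : Euclid3) i * k u * r ^ 3) (Set.Ioi 0) := by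
    intro r (hr : 0 < r)
    by_cases hrh : r ≤ h u
    · have : r • (u : Euclid3) ∈ {x | ‖x‖ ≤ h x} := by
        simpa [norm_smul, abs_of_pos hr, hh r hr] using hrh
      simp only [Set.indicator_of_mem this, Set.indicator_of_mem (Set.mem_Iic.2 hrh), kh r hr,
        PiLp.smul_apply, smul_eq_mul]
      ring
    · have : r • (u : Euclid3) ∉ {x | ‖x‖ ≤ h x} := by
        simpa [norm_smul, abs_of_pos hr, hh r hr] using hrh
      simp only [Set.indicator_of_notMem this, Set.indicator_of_notMem (mt Set.mem_Iic.1 hrh),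
        mul_zero]
  simp only
  rw [setIntegral_congr_fun measurableSet_Ioi hfun, setIntegral_indicator measurableSet_Iic,
    Set.Ioi_inter_Iic, ← intervalIntegral.integral_of_le (h0 u),
    intervalIntegral.integral_const_mul, integral_pow]
  ring

theorem setIntegral_star_eq_closedBall (hm : Measurable h)
    (hh : ∀ r : ℝ, 0 < r → ∀ x, h (r • x) = h x)
    (h0 : ∀ x, 0 ≤ h x) (hH : ∀ x, h x ≤ H) (i : Fin 3) :
    ∫ x in {x | ‖x‖ ≤ h x}, x i = ∫ x in Metric.closedBall (0 : Euclid3) 1, x i * h x ^ 4 := by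
  have hball : Metric.closedBall (0 : Euclid3) 1 = {x | ‖x‖ ≤ (fun _ => 1 : Euclid3 → ℝ) x} := by
    ext; simp
  have e1 := setIntegral_star hm (measurable_const (a := (1 : ℝ))) hh (fun _ _ _ => rfl) h0 hH
    (fun _ => (abs_one (α := ℝ)).le) i
  have e2 := setIntegral_star (k := fun x => h x ^ 4) (B := H ^ 4)
    (measurable_const (a := (1 : ℝ))) (hm.pow_const 4) (fun _ _ _ => rfl)
    (fun r hr x => by simp only [hh r hr x]) (fun _ => zero_le_one) (fun _ => le_rfl)
    (fun x => by
      rw [abs_of_nonneg (pow_nonneg (h0 x) 4)]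
      exact pow_le_pow_left₀ (h0 x) (hH x) 4) i
  rw [hball, e2]
  simpa using e1

end StarBody

theorem ae_coord_ne_zero (i : Fin 3) : ∀ᵐ x : Euclid3, x i ≠ 0 := by
  have h := Measure.addHaar_submodule (volume : Measure Euclid3)
    (LinearMap.ker (EuclideanSpace.proj i : Euclid3 →L[ℝ] ℝ).toLinearMap) fun htop => by
      have : EuclideanSpace.single i (1 : ℝ) ∈
          LinearMap.ker (EuclideanSpace.proj i : Euclid3 →L[ℝ] ℝ).toLinearMap := by simp [htop]
      simp at this
  refine measure_mono_null (fun x hx => ?_) h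
  simpa using hx

theorem setIntegral_closedBall_eq_zero_of_odd (e : Euclid3 ≃ₗᵢ[ℝ] Euclid3) {f : Euclid3 → ℝ}
    (hf : ∀ x, f (e x) = -f x) : ∫ x in Metric.closedBall (0 : Euclid3) 1, f x = 0 := by
  have h := e.measurePreserving.setIntegral_preimage_emb
    e.toHomeomorph.measurableEmbedding f (Metric.closedBall 0 1)
  rw [e.preimage_closedBall, map_zero] at h
  simp_rw [hf] at h
  rw [integral_neg] at h
  linarith

/-- The reflection changing the sign of the `i`-th coordinate. -/
noncomputable def coordFlip (i : Fin 3) : Euclid3 ≃ₗᵢ[ℝ] Euclid3 :=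
  LinearIsometryEquiv.piLpCongrRight 2 fun j =>
    if j = i then LinearIsometryEquiv.neg ℝ else LinearIsometryEquiv.refl ℝ ℝ

theorem coordFlip_same (i : Fin 3) (x : Euclid3) : coordFlip i x i = -x i := by
  simp [coordFlip]

theorem coordFlip_of_ne {i j : Fin 3} (h : j ≠ i) (x : Euclid3) : coordFlip i x j = x j := by
  simp [coordFlip, h]

/-- The reflection exchanging the first two coordinates. -/
noncomputable def coordSwap : Euclid3 ≃ₗᵢ[ℝ] Euclid3 :=
  LinearIsometryEquiv.piLpCongrLeft 2 ℝ ℝ (Equiv.swap 0 1)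

theorem coordSwap_apply (x : Euclid3) (i : Fin 3) : coordSwap x i = x (Equiv.swap 0 1 i) := by
  simp [coordSwap, LinearIsometryEquiv.piLpCongrLeft_apply, Equiv.piCongrLeft'_apply]

/-- The unscaled, unperturbed radial function, in terms of the sine of the latitude. -/
noncomputable def profile (m : ℝ → ℝ) (x : Euclid3) : ℝ := m (x 2 / ‖x‖)

/-- The moment of `p ∘ ρ_c` against the weight `x₃ ρ_M⁴`. -/
noncomputable def moment (m p : ℝ → ℝ) (c : ℝ) : ℝ :=
  ∫ x in Metric.closedBall (0 : Euclid3) 1, x 2 * profile m x ^ 4 * p (rhoExt c x)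

theorem measurable_profile {m : ℝ → ℝ} (hm : Continuous m) : Measurable (profile m) :=
  hm.measurable.comp ((measurable_coord 2).div measurable_norm)

theorem coord_div_norm_mem_Icc (x : Euclid3) (i : Fin 3) : x i / ‖x‖ ∈ Set.Icc (-1 : ℝ) 1 := by
  rw [Set.mem_Icc, ← abs_le, abs_div, abs_norm]
  exact div_le_one_of_le₀ (abs_coord_le_norm x i) (norm_nonneg x)

theorem exists_abs_le_of_continuous {m : ℝ → ℝ} (hm : Continuous m) :
    ∃ M, ∀ s ∈ Set.Icc (-1 : ℝ) 1, |m s| ≤ M :=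
  isCompact_Icc.exists_bound_of_continuousOn hm.continuousOn

theorem exists_bound_moment {m p : ℝ → ℝ} (hm : Continuous m) (hp : Continuous p) :
    ∃ M, ∀ c : ℝ, ∀ x ∈ Metric.closedBall (0 : Euclid3) 1,
      ‖x 2 * profile m x ^ 4 * p (rhoExt c x)‖ ≤ M := by
  obtain ⟨M, hM⟩ := exists_abs_le_of_continuous hm
  obtain ⟨N, hN⟩ := exists_abs_le_of_continuous hp
  refine ⟨1 * M ^ 4 * N, fun c x hx => ?_⟩
  have h1 : |x 2| ≤ 1 := (abs_coord_le_norm x 2).trans (mem_closedBall_zero_iff.1 hx)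
  have h2 : |profile m x| ≤ M := hM _ (coord_div_norm_mem_Icc x 2)
  have h3 : |p (rhoExt c x)| ≤ N := hN _ (abs_le.1 (abs_rhoExt_le c x))
  rw [norm_mul, norm_mul, norm_pow, norm_eq_abs, norm_eq_abs, norm_eq_abs]
  gcongr

theorem measurable_moment_integrand {m p : ℝ → ℝ} (hm : Continuous m) (hp : Continuous p) (c : ℝ) :
    Measurable fun x : Euclid3 => x 2 * profile m x ^ 4 * p (rhoExt c x) :=
  ((measurable_coord 2).mul ((measurable_profile hm).pow_const 4)).mul
    (hp.measurable.comp (measurable_rhoExt c))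

theorem integrableOn_moment {m p : ℝ → ℝ} (hm : Continuous m) (hp : Continuous p) (c : ℝ) :
    IntegrableOn (fun x : Euclid3 => x 2 * profile m x ^ 4 * p (rhoExt c x))
      (Metric.closedBall 0 1) := by
  obtain ⟨M, hM⟩ := exists_bound_moment hm hp
  exact IntegrableOn.of_bound measure_closedBall_lt_top
    (measurable_moment_integrand hm hp c).aestronglyMeasurable M
    ((ae_restrict_iff' measurableSet_closedBall).2 (.of_forall (hM c)))

theorem continuousOn_moment {m p : ℝ → ℝ} (hm : Continuous m) (hp : Continuous p) :
    ContinuousOn (moment m p) (Set.Icc 0 1) := by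
  obtain ⟨M, hM⟩ := exists_bound_moment hm hp
  refine continuousOn_of_dominated (bound := fun _ => M)
    (fun c _ => (measurable_moment_integrand hm hp c).aestronglyMeasurable)
    (fun c _ => (ae_restrict_iff' measurableSet_closedBall).2 (.of_forall (hM c)))
    (integrableOn_const measure_closedBall_lt_top.ne) (ae_restrict_of_ae ?_)
  filter_upwards [ae_coord_ne_zero 0] with x hx
  exact continuousOn_const.mul (hp.comp_continuousOn (continuousOn_rhoExt (.inl hx)))

theorem setIntegral_closedBall_pos {f : Euclid3 → ℝ}
    (hf : IntegrableOn f (Metric.closedBall 0 1)) (hpos : ∀ᵐ x, 0 < f x) :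
    0 < ∫ x in Metric.closedBall (0 : Euclid3) 1, f x := by
  have hpos' := ae_restrict_of_ae (s := Metric.closedBall (0 : Euclid3) 1) hpos
  refine (integral_pos_iff_support_of_nonneg_ae (hpos'.mono fun x hx => hx.le) hf).2 ?_
  have hsupp : Function.support f =ᵐ[volume.restrict (Metric.closedBall 0 1)] Set.univ :=
    Filter.eventuallyEq_univ.2 (hpos'.mono fun x hx => hx.ne')
  rw [measure_congr hsupp, Measure.restrict_apply_univ]
  exact Metric.measure_closedBall_pos volume 0 one_pos

theorem profile_coordFlip {m : ℝ → ℝ} (heven : ∀ s, m (-s) = m s) (i : Fin 3) (x : Euclid3) :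
    profile m (coordFlip i x) = profile m x := by
  rw [profile, profile, LinearIsometryEquiv.norm_map]
  rcases eq_or_ne 2 i with rfl | h
  · rw [coordFlip_same, neg_div, heven]
  · rw [coordFlip_of_ne h]

theorem rhoExt_coordFlip {i : Fin 3} (hi : i ≠ 2) (c : ℝ) (x : Euclid3) :
    rhoExt c (coordFlip i x) = rhoExt c x := by
  have h (j : Fin 3) : coordFlip i x j ^ 2 = x j ^ 2 := by
    rcases eq_or_ne j i with rfl | h
    · rw [coordFlip_same, neg_sq]
    · rw [coordFlip_of_ne h]
  exact rhoExt_congr c (h 0) (h 1) (coordFlip_of_ne hi.symm x)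

theorem moment_one_eq_zero {m : ℝ → ℝ} (heven : ∀ s, m (-s) = m s) (c : ℝ) :
    moment m (fun _ => 1) c = 0 := by
  refine setIntegral_closedBall_eq_zero_of_odd (coordFlip 2) fun x => ?_
  rw [profile_coordFlip heven, coordFlip_same]
  ring

theorem moment_id_one_pos {m : ℝ → ℝ} (hm : Continuous m) (hpos : ∀ s, 0 < m s) :
    0 < moment m id 1 := by
  refine setIntegral_closedBall_pos (integrableOn_moment hm continuous_id 1) ?_
  filter_upwards [ae_coord_ne_zero 0, ae_coord_ne_zero 2] with x h0 h2
  have hn : 0 < ‖x‖ := norm_pos_iff.2 fun h => h0 (by simp [h])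
  have hp : 0 < profile m x := hpos _
  rw [id, rhoExt_one (.inl h0)]
  have : x 2 * profile m x ^ 4 * (x 2 / ‖x‖) = x 2 ^ 2 * profile m x ^ 4 / ‖x‖ := by ring
  rw [this]
  positivity

theorem moment_id_zero_neg {m : ℝ → ℝ} (hm : Continuous m) (hpos : ∀ s, 0 < m s) :
    moment m id 0 < 0 := by
  let q : Euclid3 → ℝ := fun x =>
    x 2 * profile m x ^ 4 * ((x 1 ^ 2 - x 0 ^ 2) / (x 0 ^ 2 + x 1 ^ 2))
  have hq : IntegrableOn q (Metric.closedBall 0 1) := by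
    obtain ⟨M, hM⟩ := exists_bound_moment hm (continuous_const (y := (1 : ℝ)))
    have hmp := measurable_profile hm
    refine IntegrableOn.of_bound measure_closedBall_lt_top
      (by fun_prop : Measurable q).aestronglyMeasurable M
      ((ae_restrict_iff' measurableSet_closedBall).2 (.of_forall fun x hx => ?_))
    refine le_trans ?_ (hM 0 x hx)
    rw [norm_mul, norm_mul (_ * _) (1 : ℝ)]
    refine mul_le_mul_of_nonneg_left ?_ (norm_nonneg _)
    rw [norm_one, norm_eq_abs, abs_div, abs_of_nonneg (by positivity : 0 ≤ x 0 ^ 2 + x 1 ^ 2)]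
    refine div_le_one_of_le₀ (abs_le.2 ⟨?_, ?_⟩) (by positivity) <;>
      nlinarith [sq_nonneg (x 0), sq_nonneg (x 1)]
  have hq0 : ∫ x in Metric.closedBall (0 : Euclid3) 1, q x = 0 := by
    refine setIntegral_closedBall_eq_zero_of_odd coordSwap fun x => ?_
    have h0 : coordSwap x 0 = x 1 := by simp [coordSwap_apply]
    have h1 : coordSwap x 1 = x 0 := by simp [coordSwap_apply]
    have h2 : coordSwap x 2 = x 2 := by
      rw [coordSwap_apply, Equiv.swap_apply_of_ne_of_ne (by decide) (by decide)]
    simp only [q, profile, LinearIsometryEquiv.norm_map, h0, h1, h2]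
    rw [add_comm (x 1 ^ 2)]
    ring
  have hi := integrableOn_moment hm continuous_id 0
  have h := setIntegral_closedBall_pos (hq.sub hi) ?_
  · simp only [Pi.sub_apply] at h
    rw [integral_sub hq hi, hq0] at h
    exact sub_pos.1 h
  filter_upwards [ae_coord_ne_zero 0, ae_coord_ne_zero 1, ae_coord_ne_zero 2] with x h0 h1 h2
  have hp : 0 < profile m x ^ 4 := pow_pos (hpos _) 4
  have h := mul_lt_mul_of_pos_left (coord_mul_rhoExt_zero_lt h0 h1 h2) hp
  simp only [Pi.sub_apply, q, id]
  nlinarith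

theorem tendsto_moment_div {m : ℝ → ℝ} (hm : Continuous m) (heven : ∀ s, m (-s) = m s) (c : ℝ) :
    Filter.Tendsto (fun d => moment m (fun s => (1 + d * s) ^ 4) c / d)
      (nhdsWithin 0 (Set.Ioi 0)) (nhds (4 * moment m id c)) := by
  have hint (k : ℕ) := integrableOn_moment hm (continuous_pow k) c
  have hexp (d : ℝ) : moment m (fun s => (1 + d * s) ^ 4) c =
      4 * d * moment m id c + 6 * d ^ 2 * moment m (· ^ 2) c + 4 * d ^ 3 * moment m (· ^ 3) c +
        d ^ 4 * moment m (· ^ 4) c := by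
    have h0 : ∑ k ∈ Finset.range 5, (Nat.choose 4 k * d ^ k) * moment m (· ^ k) c =
        moment m (fun s => (1 + d * s) ^ 4) c := by
      simp only [moment]
      simp_rw [← integral_const_mul]
      rw [← integral_finsetSum _ fun k _ => (hint k).const_mul _]
      congr 1 with x
      simp [Finset.sum_range_succ, Nat.choose]
      ring
    have h1 : moment m (fun s => s) c = moment m id c := rfl
    rw [← h0]
    simp [Finset.sum_range_succ, Nat.choose, moment_one_eq_zero heven, h1]
  have hcont : Filter.Tendsto (fun d : ℝ => 4 * moment m id c + 6 * d * moment m (· ^ 2) c +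
      4 * d ^ 2 * moment m (· ^ 3) c + d ^ 3 * moment m (· ^ 4) c)
      (nhdsWithin 0 (Set.Ioi 0)) (nhds (4 * moment m id c)) := by
    refine (Continuous.tendsto' (by fun_prop) 0 _ ?_).mono_left nhdsWithin_le_nhds
    simp
  refine hcont.congr' (eventually_mem_nhdsWithin.mono fun d (hd : 0 < d) => ?_)
  simp only
  rw [hexp]
  field_simp

/-- For every small `d`, the moment of the perturbed body vanishes for some `c`. -/
theorem exists_moment_eq_zero {m : ℝ → ℝ} (hm : Continuous m) (hpos : ∀ s, 0 < m s)
    (heven : ∀ s, m (-s) = m s) :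
    ∃ c₁ c₂ d₀ : ℝ, 0 < c₁ ∧ c₁ < c₂ ∧ c₂ < 1 ∧ 0 < d₀ ∧ d₀ < 1 ∧
      ∀ d ∈ Set.Ioo 0 d₀, ∃ c ∈ Set.Icc c₁ c₂, moment m (fun s => (1 + d * s) ^ 4) c = 0 := by
  have hG := continuousOn_moment hm continuous_id
  have hlow : ∀ᶠ c in nhdsWithin (0 : ℝ) (Set.Ioi 0), moment m id c < 0 :=
    (((hG 0 (by simp)).mono_left (nhdsWithin_le_iff.2 (Icc_mem_nhdsGT one_pos))).eventually
      (Iio_mem_nhds (moment_id_zero_neg hm hpos)))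
  have hhigh : ∀ᶠ c in nhdsWithin (1 : ℝ) (Set.Iio 1), 0 < moment m id c :=
    (((hG 1 (by simp)).mono_left (nhdsWithin_le_iff.2 (Icc_mem_nhdsLT one_pos))).eventually
      (Ioi_mem_nhds (moment_id_one_pos hm hpos)))
  obtain ⟨c₁, hc₁, h1⟩ :=
    (hlow.and (Ioo_mem_nhdsGT (by norm_num : (0 : ℝ) < 1 / 2))).exists
  obtain ⟨c₂, hc₂, h2⟩ :=
    (hhigh.and (Ioo_mem_nhdsLT (by norm_num : (1 / 2 : ℝ) < 1))).exists
  have ev : ∀ᶠ d in nhdsWithin (0 : ℝ) (Set.Ioi 0),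
      moment m (fun s => (1 + d * s) ^ 4) c₁ < 0 ∧ 0 < moment m (fun s => (1 + d * s) ^ 4) c₂ := by
    filter_upwards [(tendsto_moment_div hm heven c₁).eventually (Iio_mem_nhds
        (by linarith : 4 * moment m id c₁ < 0)),
      (tendsto_moment_div hm heven c₂).eventually (Ioi_mem_nhds
        (by linarith : 0 < 4 * moment m id c₂)), eventually_mem_nhdsWithin] with d e1 e2 (hd : 0 < d)
    exact ⟨by simpa using (div_lt_iff₀ hd).1 e1, by simpa using (lt_div_iff₀ hd).1 e2⟩
  obtain ⟨δ, hδ, hev⟩ := mem_nhdsGT_iff_exists_Ioo_subset.1 ev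
  refine ⟨c₁, c₂, min δ (1 / 2), h1.1, h1.2.trans h2.1, h2.2, lt_min hδ (by norm_num),
    (min_le_right _ _).trans_lt (by norm_num), fun d hd => ?_⟩
  obtain ⟨e1, e2⟩ := hev ⟨hd.1, hd.2.trans_le (min_le_left _ _)⟩
  have hcont := (continuousOn_moment hm (p := fun s => (1 + d * s) ^ 4) (by fun_prop)).mono
    (Set.Icc_subset_Icc h1.1.le h2.2.le)
  exact intermediate_value_Icc (h1.2.trans h2.1).le hcont ⟨e1.le, e2.le⟩

/-- The radial function of `KbodyM`, homogeneous of degree `0`. -/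
noncomputable def radial (m : ℝ → ℝ) (R c d : ℝ) (x : Euclid3) : ℝ :=
  R * profile m x * (1 + d * rhoExt c x)

theorem radial_smul (m : ℝ → ℝ) (R c d r : ℝ) (hr : 0 < r) (x : Euclid3) :
    radial m R c d (r • x) = radial m R c d x := by
  simp only [radial, profile, rhoExt_smul c hr, norm_smul, PiLp.smul_apply, smul_eq_mul,
    norm_of_nonneg hr.le, mul_div_mul_left _ _ hr.ne']

theorem one_add_mul_rhoExt_nonneg {d : ℝ} (hd : d ∈ Set.Icc (0 : ℝ) 1) (c : ℝ) (x : Euclid3) :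
    0 ≤ 1 + d * rhoExt c x := by
  have h := (abs_le.1 (abs_rhoExt_le c x)).1
  nlinarith [hd.1, hd.2]

theorem setIntegral_radial_coord {m : ℝ → ℝ} (hm : Continuous m) (hpos : ∀ s, 0 < m s) {R d : ℝ}
    (hR : 0 ≤ R) (hd : d ∈ Set.Icc (0 : ℝ) 1) (c : ℝ) (i : Fin 3) :
    ∫ x in {x | ‖x‖ ≤ radial m R c d x}, x i =
      ∫ x in Metric.closedBall (0 : Euclid3) 1, x i * radial m R c d x ^ 4 := by
  obtain ⟨M, hM⟩ := exists_abs_le_of_continuous hm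
  refine setIntegral_star_eq_closedBall (H := R * M * (1 + 1)) ?_
    (fun r hr x => radial_smul m R c d r hr x) (fun x => ?_) (fun x => ?_) i
  · have h1 := measurable_profile hm
    have h2 := measurable_rhoExt c
    unfold radial
    fun_prop
  · exact mul_nonneg (mul_nonneg hR (hpos _).le) (one_add_mul_rhoExt_nonneg hd c x)
  · have h1 : profile m x ≤ M := (le_abs_self _).trans (hM _ (coord_div_norm_mem_Icc x 2))
    have h2 : d * rhoExt c x ≤ 1 := by
      have h := (abs_le.1 (abs_rhoExt_le c x)).2
      nlinarith [hd.1, hd.2]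
    have h3 : 0 ≤ M := (hpos _).le.trans h1
    have h4 := one_add_mul_rhoExt_nonneg hd c x
    unfold radial
    gcongr

theorem setIntegral_radial_coord_eq_zero {m : ℝ → ℝ} (hm : Continuous m) (hpos : ∀ s, 0 < m s)
    (heven : ∀ s, m (-s) = m s) {R c d : ℝ} (hR : 0 ≤ R) (hd : d ∈ Set.Icc (0 : ℝ) 1)
    (hzero : moment m (fun s => (1 + d * s) ^ 4) c = 0) (i : Fin 3) :
    ∫ x in {x | ‖x‖ ≤ radial m R c d x}, x i = 0 := by
  rw [setIntegral_radial_coord hm hpos hR hd]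
  rcases eq_or_ne i 2 with rfl | hi
  · have h : ∀ x : Euclid3, x 2 * radial m R c d x ^ 4 =
        R ^ 4 * (x 2 * profile m x ^ 4 * (1 + d * rhoExt c x) ^ 4) := fun x => by
      unfold radial; ring
    simp_rw [h]
    rw [integral_const_mul]
    exact mul_eq_zero_of_right _ hzero
  · refine setIntegral_closedBall_eq_zero_of_odd (coordFlip i) fun x => ?_
    rw [radial, radial, profile_coordFlip heven, rhoExt_coordFlip hi, coordFlip_same]
    ring

theorem exists_cos_sin_eq {a b : ℝ} (h : a ^ 2 + b ^ 2 = 1) :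
    ∃ φ ∈ Set.Ico 0 (2 * π), cos φ = a ∧ sin φ = b := by
  have hn : ‖(⟨a, b⟩ : ℂ)‖ = 1 := by
    rw [← sq_eq_sq₀ (norm_nonneg _) zero_le_one, Complex.sq_norm, Complex.normSq_mk]
    linarith
  have hz : (⟨a, b⟩ : ℂ) ≠ 0 := norm_ne_zero_iff.1 (by simp [hn])
  have hc : cos (Complex.arg ⟨a, b⟩) = a := by rw [Complex.cos_arg hz, hn, div_one]
  have hs : sin (Complex.arg ⟨a, b⟩) = b := by rw [Complex.sin_arg, hn, div_one]
  have h1 := Complex.neg_pi_lt_arg ⟨a, b⟩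
  have h2 := Complex.arg_le_pi ⟨a, b⟩
  rcases le_or_gt 0 (Complex.arg ⟨a, b⟩) with h0 | h0
  · exact ⟨_, ⟨h0, by linarith [pi_pos]⟩, hc, hs⟩
  · exact ⟨Complex.arg ⟨a, b⟩ + 2 * π, ⟨by linarith, by linarith⟩, by rw [cos_add_two_pi, hc],
      by rw [sin_add_two_pi, hs]⟩

theorem exists_eq_norm_smul_sph {x : Euclid3} (hx : x 0 ≠ 0) :
    ∃ φ ∈ Set.Ico 0 (2 * π), x = ‖x‖ • sph (arcsin (x 2 / ‖x‖)) φ := by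
  have hn : 0 < ‖x‖ := norm_pos_iff.2 fun h => hx (by simp [h])
  obtain ⟨h1, h2⟩ := coord_div_norm_mem_Icc x 2
  have hcos : 0 < cos (arcsin (x 2 / ‖x‖)) := by
    obtain ⟨h3, h4⟩ := coord_div_norm_mem (.inl hx)
    exact cos_pos_of_mem_Ioo ⟨neg_pi_div_two_lt_arcsin.2 h3, arcsin_lt_pi_div_two.2 h4⟩
  have hsin := sin_arcsin h1 h2
  have hsq := sin_sq_add_cos_sq (arcsin (x 2 / ‖x‖))
  rw [hsin] at hsq
  set C := cos (arcsin (x 2 / ‖x‖)) with hC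
  have hunit : (x 0 / (‖x‖ * C)) ^ 2 + (x 1 / (‖x‖ * C)) ^ 2 = 1 := by
    have hnorm := norm_sq_eq x
    field_simp at hsq ⊢
    linarith
  obtain ⟨φ, hφ, hc, hs⟩ := exists_cos_sin_eq hunit
  refine ⟨φ, hφ, ?_⟩
  ext i
  fin_cases i
  · simp [hc, ← hC]; field_simp
  · simp [hs, ← hC]; field_simp
  · simp [hsin]; field_simp

theorem continuous_sph (φ : ℝ) : Continuous fun θ => sph θ φ := by
  refine (EuclideanSpace.equiv (Fin 3) ℝ).symm.continuous.comp (continuous_pi fun i => ?_)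
  fin_cases i
  · exact continuous_cos.mul continuous_const
  · exact continuous_cos.mul continuous_const
  · exact continuous_sin

theorem neg_sph_zero (θ : ℝ) : -sph θ 0 = sph (-θ) π := by
  ext i
  fin_cases i <;> simp

theorem KbodyM_ae_eq {ρM : Euclid3 → ℝ} (hrot : ∀ θ φ φ' : ℝ, ρM (sph θ φ) = ρM (sph θ φ'))
    {R c d : ℝ}
    (hc : c ∈ Set.Ioo (0 : ℝ) 1) :
    KbodyM ρM R c d =ᵐ[volume]
      {x | ‖x‖ ≤ radial (fun s => ρM (sph (arcsin s) 0)) R c d x} := by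
  have hrad {θ φ l : ℝ} (hθ : θ ∈ Set.Ioo (-(π/2)) (π/2)) (hl : 0 < l) :
      radial (fun s => ρM (sph (arcsin s) 0)) R c d (l • sph θ φ) =
        R * ρM (sph θ φ) * (1 + d * rhoc c θ φ) := by
    rw [radial_smul _ _ _ _ _ hl, radial, rhoc_eq_rhoExt hc hθ, profile, norm_sph, sph_two, div_one,
      arcsin_sin hθ.1.le hθ.2.le, hrot θ 0 φ]
  filter_upwards [ae_coord_ne_zero 0] with x hx
  refine propext ⟨?_, fun h => ?_⟩
  · rintro ⟨θ, hθ, φ, -, l, hl0, hl, rfl⟩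
    simp only [PiLp.smul_apply, sph_zero, smul_eq_mul, ne_eq, mul_eq_zero, not_or] at hx
    have hθ' : θ ∈ Set.Ioo (-(π/2)) (π/2) := by
      refine ⟨hθ.1.lt_of_ne fun h => hx.2.1 ?_, hθ.2.lt_of_ne fun h => hx.2.1 ?_⟩
      · rw [← h, cos_neg, cos_pi_div_two]
      · rw [h, cos_pi_div_two]
    have hl' : 0 < l := hl0.lt_of_ne' hx.1
    show ‖_‖ ≤ radial _ _ _ _ _
    rw [hrad hθ' hl', norm_smul, norm_sph, mul_one, norm_of_nonneg hl0]
    exact hl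
  · have hn : 0 < ‖x‖ := norm_pos_iff.2 fun h => hx (by simp [h])
    obtain ⟨h1, h2⟩ := coord_div_norm_mem (.inl hx)
    have hθ : arcsin (x 2 / ‖x‖) ∈ Set.Ioo (-(π/2)) (π/2) :=
      ⟨neg_pi_div_two_lt_arcsin.2 h1, arcsin_lt_pi_div_two.2 h2⟩
    obtain ⟨φ, hφ, hxe⟩ := exists_eq_norm_smul_sph hx
    refine ⟨_, Set.Ioo_subset_Icc_self hθ, φ, hφ, ‖x‖, hn.le, ?_, hxe⟩
    rw [← hrad hθ hn, ← hxe]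
    exact h

theorem setIntegral_eq_zero_of_coord {s : Set Euclid3} (h : ∀ i, ∫ x in s, x i = 0) :
    ∫ x in s, x = 0 := by
  by_cases hi : IntegrableOn (fun x => x) s
  · ext i
    have := (EuclideanSpace.proj i : Euclid3 →L[ℝ] ℝ).integral_comp_comm hi
    exact this.symm.trans (h i)
  · exact integral_undef hi

/-- Lemma 4.11: the centering lemma for the mono-monostatic construction in a rotationally
symmetric normed 3-space whose unit ball has radial function `ρ_M`. -/
theorem stmt_19 (ρM : EuclideanSpace ℝ (Fin 3) → ℝ)
    (hcont : ContinuousOn ρM (Metric.sphere (0 : EuclideanSpace ℝ (Fin 3)) 1))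
    (hpos : ∀ u : EuclideanSpace ℝ (Fin 3), ‖u‖ = 1 → 0 < ρM u)
    (hsymm : ∀ u : EuclideanSpace ℝ (Fin 3), ‖u‖ = 1 → ρM (-u) = ρM u)
    (hrot : ∀ θ φ φ' : ℝ, ρM (sph θ φ) = ρM (sph θ φ'))
    (R : ℝ) (hR : 0 < R) :
    ∃ c₁ c₂ d₀ : ℝ, 0 < c₁ ∧ c₁ < c₂ ∧ c₂ < 1 ∧ 0 < d₀ ∧ d₀ < 1 ∧
      ∃ F : ℝ → ℝ, (∀ d ∈ Set.Ioo 0 d₀, F d ∈ Set.Icc c₁ c₂) ∧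
        ∀ d ∈ Set.Ioo 0 d₀,
          ∫ x in KbodyM ρM R (F d) d, x ∂volume = (0 : EuclideanSpace ℝ (Fin 3)) := by
  let m : ℝ → ℝ := fun s => ρM (sph (arcsin s) 0)
  have hm : Continuous m :=
    hcont.comp_continuous ((continuous_sph 0).comp continuous_arcsin) fun s => by simp
  have hmpos : ∀ s, 0 < m s := fun s => hpos _ (norm_sph _ _)
  have heven : ∀ s, m (-s) = m s := fun s => by
    simp only [m]
    rw [arcsin_neg, hrot _ 0 π, ← neg_sph_zero, hsymm _ (norm_sph _ _)]
  obtain ⟨c₁, c₂, d₀, h1, h12, h2, hd0, hd1, hF⟩ := exists_moment_eq_zero hm hmpos heven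
  choose! F hFmem hFzero using hF
  refine ⟨c₁, c₂, d₀, h1, h12, h2, hd0, hd1, F, hFmem, fun d hd => ?_⟩
  have hc : F d ∈ Set.Ioo (0 : ℝ) 1 :=
    ⟨h1.trans_le (hFmem d hd).1, (hFmem d hd).2.trans_lt h2⟩
  rw [setIntegral_congr_set (KbodyM_ae_eq hrot hc)]
  exact setIntegral_eq_zero_of_coord fun i => setIntegral_radial_coord_eq_zero hm hmpos heven hR.le
    ⟨hd.1.le, (hd.2.trans hd1).le⟩ (hFzero d hd) i
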